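/- arXiv:1802.09340 — 3 statements merged into one kernel-verified Lean document; each statement's English description precedes it below -/
import Mathlib

section
/- There exists a magic knight's tour of the 4×20 board: a knight's tour in which each of the four 20-cell rows sums to 810 and each of the twenty 4-cell columns sums to 162. -/
/-- Two cells are a knight's move apart: coordinate differences in absolute
value are {1,2}. -/
def knightMove {m n : ℕ} (a b : Fin m × Fin n) : Prop :=
  (((a.1.val : ℤ) - b.1.val).natAbs = 1 ∧ ((a.2.val : ℤ) - b.2.val).natAbs = 2) ∨
  (((a.1.val : ℤ) - b.1.val).natAbs = 2 ∧ ((a.2.val : ℤ) - b.2.val).natAbs = 1)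

/-- A knight's tour of the m×n board: a bijective numbering (as an equiv from
`Fin (m*n)`, representing the numbers 1,…,m·n) of the cells, such that
consecutive numbers occupy cells a knight's move apart. -/
def IsKnightTour (m n : ℕ) (t : Fin (m * n) ≃ Fin m × Fin n) : Prop :=
  ∀ (k : ℕ) (h : k + 1 < m * n),
    knightMove (t ⟨k, Nat.lt_of_succ_lt h⟩) (t ⟨k + 1, h⟩)

/-- The number (in 1,…,m·n) assigned to a cell by the tour. -/
def cellNum {m n : ℕ} (t : Fin (m * n) ≃ Fin m × Fin n) (c : Fin m × Fin n) : ℕ :=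
  (t.symm c).val + 1

/-- The sum of the numbers in row `i` (an n-cell line). -/
def rowSum {m n : ℕ} (t : Fin (m * n) ≃ Fin m × Fin n) (i : Fin m) : ℕ :=
  ∑ j : Fin n, cellNum t (i, j)

/-- The sum of the numbers in column `j` (an m-cell line). -/
def colSum {m n : ℕ} (t : Fin (m * n) ≃ Fin m × Fin n) (j : Fin n) : ℕ :=
  ∑ i : Fin m, cellNum t (i, j)

/-- The numbering of the cells of a magic knight's tour of the 4×20 board. -/
def magicNumbering : Vector (Vector ℕ 20) 4 :=
  #v[#v[39, 42, 3, 80, 35, 46, 7, 50, 33, 72, 29, 54, 27, 68, 17, 56, 15, 60, 19, 58],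
    #v[2, 79, 38, 41, 6, 75, 34, 73, 30, 49, 10, 69, 12, 55, 14, 65, 18, 57, 22, 61],
    #v[43, 40, 77, 4, 45, 36, 47, 8, 51, 32, 71, 28, 53, 26, 67, 16, 63, 24, 59, 20],
    #v[78, 1, 44, 37, 76, 5, 74, 31, 48, 9, 52, 11, 70, 13, 64, 25, 66, 21, 62, 23]]

/-- The cells of the board in the order in which `magicNumbering` visits them. -/
def magicCells : Vector (Fin 4 × Fin 20) 80 :=
  #v[(3, 1), (1, 0), (0, 2), (2, 3), (3, 5), (1, 4), (0, 6), (2, 7),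
    (3, 9), (1, 10), (3, 11), (1, 12), (3, 13), (1, 14), (0, 16), (2, 15),
    (0, 14), (1, 16), (0, 18), (2, 19), (3, 17), (1, 18), (3, 19), (2, 17),
    (3, 15), (2, 13), (0, 12), (2, 11), (0, 10), (1, 8), (3, 7), (2, 9),
    (0, 8), (1, 6), (0, 4), (2, 5), (3, 3), (1, 2), (0, 0), (2, 1),
    (1, 3), (0, 1), (2, 0), (3, 2), (2, 4), (0, 5), (2, 6), (3, 8),
    (1, 9), (0, 7), (2, 8), (3, 10), (2, 12), (0, 11), (1, 13), (0, 15),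
    (1, 17), (0, 19), (2, 18), (0, 17), (1, 19), (3, 18), (2, 16), (3, 14),
    (1, 15), (3, 16), (2, 14), (0, 13), (1, 11), (3, 12), (2, 10), (0, 9),
    (1, 7), (3, 6), (1, 5), (3, 4), (2, 2), (3, 0), (1, 1), (0, 3)]

/-- The number of a cell in `magicNumbering`, counted from zero. -/
def magicIndex (c : Fin 4 × Fin 20) : Fin (4 * 20) :=
  Fin.ofNat 80 (magicNumbering[c.1][c.2] - 1)

/-- The magic knight's tour given by `magicNumbering`. -/
def magicTour : Fin (4 * 20) ≃ Fin 4 × Fin 20 where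
  toFun k := magicCells.get k
  invFun := magicIndex
  left_inv := by unfold Function.LeftInverse; decide +kernel
  right_inv := by unfold Function.RightInverse Function.LeftInverse; decide +kernel

theorem isKnightTour_magicTour : IsKnightTour 4 20 magicTour := by
  have key : ∀ k : Fin 79, knightMove (magicTour (k.castSucc : Fin 80)) (magicTour k.succ) := by
    unfold knightMove
    decide +kernel
  intro k h
  exact key ⟨k, by omega⟩

theorem rowSum_magicTour : ∀ i, rowSum magicTour i = 810 := by
  decide +kernel

theorem colSum_magicTour : ∀ j, colSum magicTour j = 162 := by
  decide +kernel

/-- There exists a magic knight's tour of the 4×20 board. -/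
theorem magic_tour_4x20 :
    ∃ t : Fin (4 * 20) ≃ Fin 4 × Fin 20, IsKnightTour 4 20 t ∧
      (∀ i : Fin 4, rowSum t i = 810) ∧ (∀ j : Fin 20, colSum t j = 162) :=
  ⟨magicTour, isKnightTour_magicTour, rowSum_magicTour, colSum_magicTour⟩
end

section
/- There exists a magic knight's tour of the 4×22 board: a knight's tour in which each of the four 22-cell rows sums to 979 and each of the twenty-two 4-cell columns sums to 178. -/
/-- The cells of a magic knight's tour of the 4×22 board, in the order of the tour. -/
def magicTour4x22Cell : Fin (4 * 22) → Fin 4 × Fin 22 :=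
  ![
    (0, 0), (1, 2), (3, 1), (2, 3), (0, 4), (1, 6), (3, 5), (2, 7), (0, 8), (2, 9), (3, 11),
    (1, 12), (3, 13), (1, 14), (3, 15), (1, 16), (0, 18), (2, 17), (0, 16), (1, 18), (0, 20),
    (2, 21), (3, 19), (1, 20), (3, 21), (2, 19), (3, 17), (2, 15), (0, 14), (2, 13), (0, 12),
    (1, 10), (3, 9), (2, 11), (0, 10), (1, 8), (3, 7), (2, 5), (0, 6), (1, 4), (3, 3), (2, 1),
    (0, 2), (1, 0), (2, 2), (3, 0), (1, 1), (0, 3), (1, 5), (3, 4), (2, 6), (0, 7), (2, 8),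
    (3, 10), (1, 11), (0, 9), (2, 10), (3, 12), (2, 14), (0, 13), (1, 15), (0, 17), (1, 19),
    (0, 21), (2, 20), (0, 19), (1, 21), (3, 20), (2, 18), (3, 16), (1, 17), (3, 18), (2, 16),
    (0, 15), (1, 13), (3, 14), (2, 12), (0, 11), (1, 9), (3, 8), (1, 7), (3, 6), (2, 4),
    (0, 5), (1, 3), (0, 1), (2, 0), (3, 2)]

/-- The positions (counted from 0) of the cells in the tour `magicTour4x22Cell`, row by row. -/
def magicTour4x22Index : Fin 4 → Fin 22 → Fin (4 * 22) :=
  ![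
    ![0, 85, 42, 47, 4, 83, 38, 51, 8, 55, 34, 77, 30, 59, 28, 73, 18, 61, 16, 65, 20, 63],
    ![43, 46, 1, 84, 39, 48, 5, 80, 35, 78, 31, 54, 11, 74, 13, 60, 15, 70, 19, 62, 23, 66],
    ![86, 41, 44, 3, 82, 37, 50, 7, 52, 9, 56, 33, 76, 29, 58, 27, 72, 17, 68, 25, 64, 21],
    ![45, 2, 87, 40, 49, 6, 81, 36, 79, 32, 53, 10, 57, 12, 75, 14, 69, 26, 71, 22, 67, 24]]

set_option maxRecDepth 100000 in
/-- The tour `magicTour4x22Cell` as a bijective numbering of the board. -/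
def magicTour4x22Equiv : Fin (4 * 22) ≃ Fin 4 × Fin 22 where
  toFun := magicTour4x22Cell
  invFun c := magicTour4x22Index c.1 c.2
  left_inv := by unfold Function.LeftInverse; decide
  right_inv := by unfold Function.RightInverse Function.LeftInverse; decide

instance {m n : ℕ} (a b : Fin m × Fin n) : Decidable (knightMove a b) :=
  inferInstanceAs (Decidable (_ ∨ _))

theorem isKnightTour_magicTour4x22Equiv : IsKnightTour 4 22 magicTour4x22Equiv := by
  have h : ∀ k : Fin 87, knightMove (magicTour4x22Equiv ⟨k.val, by omega⟩)
      (magicTour4x22Equiv ⟨k.val + 1, by omega⟩) := by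
    decide +kernel
  exact fun k hk => h ⟨k, by omega⟩

theorem rowSum_magicTour4x22Equiv (i : Fin 4) : rowSum magicTour4x22Equiv i = 979 := by
  revert i
  decide +kernel

theorem colSum_magicTour4x22Equiv (j : Fin 22) : colSum magicTour4x22Equiv j = 178 := by
  revert j
  decide +kernel

/-- There exists a magic knight's tour of the 4×22 board. -/
theorem magic_tour_4x22 :
    ∃ t : Fin (4 * 22) ≃ Fin 4 × Fin 22, IsKnightTour 4 22 t ∧
      (∀ i : Fin 4, rowSum t i = 979) ∧ (∀ j : Fin 22, colSum t j = 178) :=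
  ⟨magicTour4x22Equiv, isKnightTour_magicTour4x22Equiv, rowSum_magicTour4x22Equiv,
    colSum_magicTour4x22Equiv⟩
end

section
/- There exists a quasi-magic knight's tour of the 6×10 board with the 6-cell lines magic: a knight's tour in which each of the ten 6-cell lines sums to the magic constant 183, and the six 10-cell lines take exactly two distinct sum values. -/
instance inst_s15 {m n : ℕ} (a b : Fin m × Fin n) : Decidable (knightMove a b) := by
  unfold knightMove
  infer_instance

/-- The cells of a quasi-magic knight's tour of the 6×10 board, in order of visit. -/
def quasiMagicPath : Fin 60 → Fin 6 × Fin 10 :=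
  ![(0, 9), (1, 7), (2, 9), (4, 8), (5, 6), (3, 7), (5, 8), (4, 6), (3, 8), (1, 9),
    (0, 7), (2, 6), (3, 4), (5, 5), (4, 3), (3, 5), (1, 4), (0, 2), (1, 0), (2, 2),
    (0, 1), (1, 3), (0, 5), (2, 4), (0, 3), (1, 1), (3, 0), (5, 1), (3, 2), (4, 0),
    (2, 1), (0, 0), (1, 2), (2, 0), (4, 1), (5, 3), (4, 5), (3, 3), (5, 4), (4, 2),
    (5, 0), (3, 1), (5, 2), (4, 4), (2, 5), (0, 4), (2, 3), (1, 5), (3, 6), (5, 7),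
    (4, 9), (2, 8), (1, 6), (0, 8), (2, 7), (0, 6), (1, 8), (3, 9), (4, 7), (5, 9)]

/-- The position, counted from 0, of each cell in `quasiMagicPath`. -/
def quasiMagicIndex : Fin 6 → Fin 10 → Fin 60 :=
  ![![31, 20, 17, 24, 45, 22, 55, 10, 53, 0],
    ![18, 25, 32, 21, 16, 47, 52, 1, 56, 9],
    ![33, 30, 19, 46, 23, 44, 11, 54, 51, 2],
    ![26, 41, 28, 37, 12, 15, 48, 5, 8, 57],
    ![29, 34, 39, 14, 43, 36, 7, 58, 3, 50],
    ![40, 27, 42, 35, 38, 13, 4, 49, 6, 59]]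

set_option maxRecDepth 4000 in
/-- A quasi-magic knight's tour of the 6×10 board, with column sums 183 and
row sums 287 and 323. -/
def quasiMagicTour : Fin (6 * 10) ≃ Fin 6 × Fin 10 where
  toFun := quasiMagicPath
  invFun c := quasiMagicIndex c.1 c.2
  left_inv := by
    change ∀ k : Fin 60, quasiMagicIndex (quasiMagicPath k).1 (quasiMagicPath k).2 = k
    decide
  right_inv := by
    change ∀ c : Fin 6 × Fin 10, quasiMagicPath (quasiMagicIndex c.1 c.2) = c
    decide

theorem isKnightTour_quasiMagicTour : IsKnightTour 6 10 quasiMagicTour := by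
  have moves : ∀ k : Fin 59, knightMove (quasiMagicPath k.castSucc) (quasiMagicPath k.succ) := by
    decide
  intro k h
  exact moves ⟨k, Nat.lt_of_succ_lt_succ h⟩

theorem colSum_quasiMagicTour : ∀ j : Fin 10, colSum quasiMagicTour j = 183 := by
  decide

theorem rowSum_quasiMagicTour :
    ∀ i : Fin 6, rowSum quasiMagicTour i = ![287, 287, 323, 287, 323, 323] i := by
  decide

/-- There exists a quasi-magic knight's tour of the 6×10 board: every
6-cell line (column) sums to the magic constant 183, and the 10-cell lines
(rows) take exactly two distinct sum values. -/
theorem quasi_magic_6x10_cols :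
    ∃ t : Fin (6 * 10) ≃ Fin 6 × Fin 10, IsKnightTour 6 10 t ∧
      (∀ j : Fin 10, colSum t j = 183) ∧
      ∃ a b : ℕ, a ≠ b ∧ (∀ i : Fin 6, rowSum t i = a ∨ rowSum t i = b) ∧
        (∃ i : Fin 6, rowSum t i = a) ∧ (∃ i : Fin 6, rowSum t i = b) := by
  exact ⟨quasiMagicTour, isKnightTour_quasiMagicTour, colSum_quasiMagicTour, 287, 323, by decide,
    fun i => by rw [rowSum_quasiMagicTour]; revert i; decide,
    ⟨0, rowSum_quasiMagicTour 0⟩, ⟨2, rowSum_quasiMagicTour 2⟩⟩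
end
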